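/- Let R be a commutative noetherian ring and X a tensor-ideal subcategory of finitely generated R-modules closed under direct summands and extensions (tensor-ideal: M ∈ X and N finitely generated implies M ⊗_R N ∈ X). Then X is a Serre subcategory. -/

import Mathlib

/-- A finite module over a domain is isomorphic to a finite free module up to a nonzero scalar. -/
theorem exists_maps_comp_eq_smul (A M : Type*) [CommRing A] [IsDomain A] [AddCommGroup M]
    [Module A M] [Module.Finite A M] :
    ∃ (n : ℕ) (a : A) (φ : M →ₗ[A] (Fin n → A)) (i : (Fin n → A) →ₗ[A] M),
      a ≠ 0 ∧ (∀ m, i (φ m) = a • m) ∧ ∀ x, φ (i x) = a • x := by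
  classical
  obtain ⟨k, v, hv⟩ := Module.Finite.exists_fin (R := A) (M := M)
  obtain ⟨s, hs, hmax⟩ := exists_maximal_linearIndepOn A v
  have hex : ∀ j, ∃ b : A, b ≠ 0 ∧ b • v j ∈ Submodule.span A (v '' s) := fun j ↦ by
    by_cases hj : j ∈ s
    · exact ⟨1, one_ne_zero,
        Submodule.smul_mem _ _ (Submodule.subset_span (Set.mem_image_of_mem v hj))⟩
    · exact hmax j hj
  choose b hb0 hb using hex
  let a := ∏ j, b j
  have ha (m : M) : a • m ∈ Submodule.span A (Set.range fun j : s ↦ v j) := by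
    rw [← Set.image_eq_range]
    have hm : m ∈ Submodule.span A (Set.range v) := hv ▸ Submodule.mem_top
    induction hm using Submodule.span_induction with
    | mem x hx =>
      obtain ⟨j, rfl⟩ := hx
      obtain ⟨c, hc⟩ : b j ∣ a := Finset.dvd_prod_of_mem b (Finset.mem_univ j)
      rw [hc, mul_comm, mul_smul]
      exact Submodule.smul_mem _ _ (hb j)
    | zero => simp
    | add x y _ _ hx hy => rw [smul_add]; exact Submodule.add_mem _ hx hy
    | smul c x _ hx => rw [smul_comm]; exact Submodule.smul_mem _ _ hx
  have hs' : LinearIndependent A fun j : s ↦ v j := hs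
  let e : Submodule.span A (Set.range fun j : s ↦ v j) ≃ₗ[A] (Fin (Fintype.card s) → A) :=
    hs'.linearCombinationEquiv.symm ≪≫ₗ Finsupp.linearEquivFunOnFinite A A s ≪≫ₗ
      LinearEquiv.funCongrLeft A A (Fintype.equivFin s).symm
  let ψ := (LinearMap.lsmul A M a).codRestrict _ ha
  have hψ (m : M) : (ψ m : M) = a • m := rfl
  refine ⟨_, a, e.toLinearMap ∘ₗ ψ,
    Submodule.subtype _ ∘ₗ e.symm.toLinearMap, Finset.prod_ne_zero_iff.2 fun j _ ↦ hb0 j,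
    fun m ↦ by simp [hψ], fun x ↦ ?_⟩
  have : ψ (e.symm x) = a • e.symm x := Subtype.ext (hψ _)
  simp [this]

/-- If `φ` and `i` are mutually inverse up to the scalar `a`, then `M` embeds into `F × M / aM`
with cokernel killed by `a ^ 2`. -/
theorem injective_prod_mkQ {A M F : Type*} [CommRing A] [AddCommGroup M] [Module A M]
    [AddCommGroup F] [Module A F] {a : A} {φ : M →ₗ[A] F} {i : F →ₗ[A] M}
    (hi : ∀ m, i (φ m) = a • m) (hφ : ∀ x, φ (i x) = a • x) (haF : ∀ x : F, a • x = 0 → x = 0) :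
    Function.Injective (φ.prod (LinearMap.range (LinearMap.lsmul A M a)).mkQ) ∧
      ∀ y, a ^ 2 • y ∈ LinearMap.range (φ.prod (LinearMap.range (LinearMap.lsmul A M a)).mkQ) := by
  constructor
  · rw [injective_iff_map_eq_zero]
    intro m hm
    obtain ⟨h₁, h₂⟩ := Prod.mk.inj hm
    obtain ⟨m', rfl⟩ := (Submodule.Quotient.mk_eq_zero _).1 h₂
    have h₁ : φ (a • m') = 0 := h₁
    have h : φ m' = 0 := haF _ (by rw [← map_smul, h₁])
    simp [← hi, h]
  · rintro ⟨x, y⟩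
    obtain ⟨m, rfl⟩ := Submodule.mkQ_surjective _ y
    refine ⟨a • i x, Prod.ext ?_ ?_⟩
    · simp [hφ, smul_smul, pow_two]
    · have h (z : M) : (LinearMap.range (LinearMap.lsmul A M a)).mkQ (a • z) = 0 :=
        (Submodule.Quotient.mk_eq_zero _).2 ⟨z, rfl⟩
      change (LinearMap.range (LinearMap.lsmul A M a)).mkQ (a • i x) =
        a ^ 2 • (LinearMap.range (LinearMap.lsmul A M a)).mkQ m
      rw [h, ← map_smul, pow_two, mul_smul, h]

/-- An extension-closed class of modules containing `0` and all `R ⧸ p` with `I ≤ p` prime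
contains every finite module killed by `I`. -/
theorem of_forall_quotient_prime {R : Type} [CommRing R] [IsNoetherianRing R]
    (X : ∀ (M : Type) [AddCommGroup M] [Module R M], Prop)
    (hiso : ∀ (M N : Type) [AddCommGroup M] [Module R M] [AddCommGroup N] [Module R N],
      (M ≃ₗ[R] N) → X M → X N)
    (hext : ∀ (A B C : Type) [AddCommGroup A] [Module R A] [AddCommGroup B] [Module R B]
        [AddCommGroup C] [Module R C] (f : A →ₗ[R] B) (g : B →ₗ[R] C),
      Function.Injective f → Function.Surjective g → Function.Exact f g → X A → X C → X B)
    (hzero : X PUnit) (I : Ideal R) (hI : ∀ p : Ideal R, p.IsPrime → I ≤ p → X (R ⧸ p))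
    (N : Type) [AddCommGroup N] [Module R N] [hN : Module.Finite R N]
    (hann : I ≤ Module.annihilator R N) : X N := by
  induction hN using IsNoetherianRing.induction_on_isQuotientEquivQuotientPrime R with
  | subsingleton N => exact hiso PUnit N (LinearEquiv.ofSubsingleton _ _) hzero
  | quotient N p e =>
    rw [e.annihilator_eq, Ideal.annihilator_quotient] at hann
    exact hiso _ _ e.symm (hI _ p.isPrime hann)
  | exact N₁ N₂ N₃ f g hf hg hfg h₁ h₃ =>
    exact hext _ _ _ f g hf hg hfg (h₁ (hann.trans (f.annihilator_le_of_injective hf)))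
      (h₃ (hann.trans (g.annihilator_le_of_surjective hg)))

/-- An extension-closed class of `R`-modules contains the target of an injective map linear over
an `R`-algebra if it contains the source and the cokernel. -/
theorem of_quotient_range {R : Type} [CommRing R]
    (X : ∀ (M : Type) [AddCommGroup M] [Module R M], Prop)
    (hext : ∀ (A B C : Type) [AddCommGroup A] [Module R A] [AddCommGroup B] [Module R B]
        [AddCommGroup C] [Module R C] (f : A →ₗ[R] B) (g : B →ₗ[R] C),
      Function.Injective f → Function.Surjective g → Function.Exact f g → X A → X C → X B)
    {S M N : Type} [CommRing S] [Algebra R S] [AddCommGroup M] [Module R M] [Module S M]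
    [IsScalarTower R S M] [AddCommGroup N] [Module R N] [Module S N] [IsScalarTower R S N]
    (f : M →ₗ[S] N) (hf : Function.Injective f) (hM : X M) (hC : X (N ⧸ LinearMap.range f)) :
    X N :=
  hext M N (N ⧸ LinearMap.range f) (f.restrictScalars R)
    ((LinearMap.range f).mkQ.restrictScalars R) hf (LinearMap.range f).mkQ_surjective
    (LinearMap.exact_map_mkQ_range f) hM hC

/-- A tensor ideal of finite modules closed under summands and extensions contains `R ⧸ p` for
every prime `p` in the support of one of its members. -/
theorem quotient_prime_of_annihilator_le {R : Type} [CommRing R] [IsNoetherianRing R]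
    (X : ∀ (M : Type) [AddCommGroup M] [Module R M], Prop)
    (hiso : ∀ (M N : Type) [AddCommGroup M] [Module R M] [AddCommGroup N] [Module R N],
      (M ≃ₗ[R] N) → X M → X N)
    (htensor : ∀ (M N : Type) [AddCommGroup M] [Module R M] [AddCommGroup N] [Module R N],
      X M → Module.Finite R N → X (TensorProduct R M N))
    (hsummand : ∀ (M N : Type) [AddCommGroup M] [Module R M] [AddCommGroup N] [Module R N],
      X (M × N) → X M)
    (hext : ∀ (A B C : Type) [AddCommGroup A] [Module R A] [AddCommGroup B] [Module R B]
        [AddCommGroup C] [Module R C] (f : A →ₗ[R] B) (g : B →ₗ[R] C),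
      Function.Injective f → Function.Surjective g → Function.Exact f g → X A → X C → X B)
    (hzero : X PUnit) (M : Type) [AddCommGroup M] [Module R M] [Module.Finite R M] (hM : X M)
    (p : Ideal R) (hp : p.IsPrime) (hann : Module.annihilator R M ≤ p) : X (R ⧸ p) := by
  induction p using IsNoetherian.induction with
  | _ p ih =>
  let M' := M ⧸ (p • ⊤ : Submodule R M)
  have hM' : X M' := hiso _ _ (TensorProduct.tensorQuotEquivQuotSMul M p)
    (htensor M (R ⧸ p) hM inferInstance)
  have hann' : Module.annihilator R M' ≤ p := by
    have h : (⟨p, hp⟩ : PrimeSpectrum R) ∈ Module.support R M' := by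
      rw [Module.support_quotient]
      exact ⟨Module.mem_support_iff_of_finite.2 hann, fun _ h ↦ h⟩
    exact Module.mem_support_iff_of_finite.1 h
  have : Module.Finite (R ⧸ p) M' := Module.Finite.of_restrictScalars_finite R (R ⧸ p) M'
  obtain ⟨n, a, φ, i, ha, hi, hφ⟩ := exists_maps_comp_eq_smul (R ⧸ p) M'
  obtain ⟨hinj, hran⟩ := injective_prod_mkQ hi hφ
    fun x hx ↦ (smul_eq_zero.1 hx).resolve_left ha
  set j := φ.prod (LinearMap.range (LinearMap.lsmul (R ⧸ p) M' a)).mkQ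
  obtain ⟨r, rfl⟩ := Ideal.Quotient.mk_surjective a
  have hr : r ∉ p := fun h ↦ ha (Ideal.Quotient.eq_zero_iff_mem.2 h)
  let C := ((Fin n → R ⧸ p) × (M' ⧸ LinearMap.range (LinearMap.lsmul (R ⧸ p) M'
    (Ideal.Quotient.mk p r)))) ⧸ LinearMap.range j
  have : Module.Finite R C := Module.Finite.trans (R ⧸ p) C
  have hC : X C := by
    refine of_forall_quotient_prime X hiso hext hzero (p ⊔ Ideal.span {r ^ 2})
      (fun q hq hle ↦ ?_) C ?_
    · obtain ⟨hpq, hrq⟩ := sup_le_iff.1 hle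
      have hrq : r ∈ q := hq.mem_of_pow_mem 2 ((Ideal.span_singleton_le_iff_mem _).1 hrq)
      exact ih q (lt_of_le_of_ne hpq fun h ↦ hr (h ▸ hrq)) hq (hann.trans hpq)
    · have hsmul (s : R) (c : C) : s • c = Ideal.Quotient.mk p s • c :=
        (algebraMap_smul (R ⧸ p) s c).symm
      refine sup_le (fun s hs ↦ Module.mem_annihilator.2 fun c ↦ ?_)
        ((Ideal.span_singleton_le_iff_mem _).2 (Module.mem_annihilator.2 fun c ↦ ?_))
      · rw [hsmul, Ideal.Quotient.eq_zero_iff_mem.2 hs, zero_smul]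
      · obtain ⟨y, rfl⟩ := Submodule.mkQ_surjective _ c
        rw [hsmul, map_pow, ← map_smul]
        exact (Submodule.Quotient.mk_eq_zero _).2 (hran y)
  have hF : X (Fin n → R ⧸ p) := hsummand _ _ (of_quotient_range X hext j hinj hM' hC)
  cases n with
  | zero =>
    refine absurd (hann' (Module.mem_annihilator.2 fun m ↦ ?_)) hr
    rw [← algebraMap_smul (R ⧸ p) r m]
    exact (hi m).symm.trans (by rw [Subsingleton.elim (φ m) 0, map_zero])
  | succ n => exact hsummand _ _ (hiso _ _ (Fin.consLinearEquiv R fun _ ↦ R ⧸ p).symm hF)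


/-- Over a commutative noetherian ring, a tensor-ideal subcategory of finitely generated
modules closed under direct summands and extensions is a Serre subcategory (closed under
submodules, quotients and extensions). -/
theorem tensor_ideal_is_serre (R : Type) [CommRing R] [IsNoetherianRing R]
    (X : ∀ (M : Type) [AddCommGroup M] [Module R M], Prop)
    (hfg : ∀ (M : Type) [AddCommGroup M] [Module R M], X M → Module.Finite R M)
    (hiso : ∀ (M N : Type) [AddCommGroup M] [Module R M] [AddCommGroup N] [Module R N],
      (M ≃ₗ[R] N) → X M → X N)
    (htensor : ∀ (M N : Type) [AddCommGroup M] [Module R M] [AddCommGroup N] [Module R N],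
      X M → Module.Finite R N → X (TensorProduct R M N))
    (hsummand : ∀ (M N : Type) [AddCommGroup M] [Module R M] [AddCommGroup N] [Module R N],
      X (M × N) → X M)
    (hext : ∀ (A B C : Type) [AddCommGroup A] [Module R A] [AddCommGroup B] [Module R B]
        [AddCommGroup C] [Module R C] (f : A →ₗ[R] B) (g : B →ₗ[R] C),
      Function.Injective f → Function.Surjective g → Function.Exact f g → X A → X C → X B) :
    (∀ (M : Type) [AddCommGroup M] [Module R M] (N : Submodule R M), X M → X ↥N) ∧
    (∀ (M : Type) [AddCommGroup M] [Module R M] (N : Submodule R M), X M → X (M ⧸ N)) := by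
  have key (M : Type) [AddCommGroup M] [Module R M] (hM : X M) (N : Type) [AddCommGroup N]
      [Module R N] [Module.Finite R N] (h : Module.annihilator R M ≤ Module.annihilator R N) :
      X N := by
    have := hfg M hM
    have hzero : X PUnit := hiso _ _
      (LinearEquiv.ofSubsingleton (TensorProduct R M PUnit) PUnit) (htensor M PUnit hM inferInstance)
    exact of_forall_quotient_prime X hiso hext hzero _
      (quotient_prime_of_annihilator_le X hiso htensor hsummand hext hzero M hM) N h
  refine ⟨fun M _ _ N hM ↦ ?_, fun M _ _ N hM ↦ ?_⟩
  · have := hfg M hM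
    exact key M hM N (N.subtype.annihilator_le_of_injective N.injective_subtype)
  · have := hfg M hM
    exact key M hM (M ⧸ N) (N.mkQ.annihilator_le_of_surjective N.mkQ_surjective)
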